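/- Let (M^{2n+1},φ,ξ,η,g) be a Sasakian manifold foliated by a flat Legendrian foliation F with tangent bundle L such that the conjugate Legendrian distribution Q = φL is integrable, and suppose the associated bi-Legendrian connection ∇ satisfies ∇g = 0. Let S be the (1,2)-tensor S(V,W) = ∇_V W − ∇̂_V W, where ∇̂ is the Levi-Civita connection. Then S(V,ξ) = S(ξ,V) = φV for all vector fields V, and S(Z,Z') = dη(Z,Z')ξ for all sections Z,Z' of the contact distribution D = ker η. In particular ∇_X X' = ∇̂_X X' for all X,X' ∈ Γ(L) and ∇_Y Y' = ∇̂_Y Y' for all Y,Y' ∈ Γ(Q). -/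

import Mathlib

/-!
Abstract framework for the calculus of smooth vector fields on a smooth
manifold `M`.  The commutative `ℝ`-algebra `F` plays the role of the ring
`C^∞(M)` of smooth real-valued functions, and the `F`-module `V` plays the
role of the `C^∞(M)`-module of smooth vector fields, together with the
action of vector fields on functions by derivations and the Lie bracket of
vector fields.
-/

structure VFCalculus (F V : Type*) [CommRing F] [Algebra ℝ F]
    [AddCommGroup V] [Module F V] where
  act : V → F → F
  act_add_left : ∀ X Y f, act (X + Y) f = act X f + act Y f
  act_smul_left : ∀ (f : F) (X : V) (g : F), act (f • X) g = f * act X g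
  act_add_right : ∀ X f g, act X (f + g) = act X f + act X g
  act_mul_right : ∀ X f g, act X (f * g) = act X f * g + f * act X g
  act_const : ∀ X (r : ℝ), act X (algebraMap ℝ F r) = 0
  bracket : V → V → V
  bracket_antisymm : ∀ X Y, bracket X Y = - bracket Y X
  bracket_add_left : ∀ X Y Z, bracket (X + Y) Z = bracket X Z + bracket Y Z
  bracket_smul_right : ∀ (f : F) (X Y : V),
    bracket X (f • Y) = act X f • Y + f • bracket X Y
  act_bracket : ∀ X Y f, act (bracket X Y) f = act X (act Y f) - act Y (act X f)
  jacobi : ∀ X Y Z,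
    bracket X (bracket Y Z) + bracket Y (bracket Z X) + bracket Z (bracket X Y) = 0

variable {F V : Type*} [CommRing F] [Algebra ℝ F] [AddCommGroup V] [Module F V]

/-- A linear (Koszul) connection on the tangent bundle. -/
def VFCalculus.IsConnection (C : VFCalculus F V) (D : V → V → V) : Prop :=
  (∀ X Y Z, D (X + Y) Z = D X Z + D Y Z) ∧
  (∀ (f : F) (X Y : V), D (f • X) Y = f • D X Y) ∧
  (∀ X Y Z, D X (Y + Z) = D X Y + D X Z) ∧
  (∀ (f : F) (X Y : V), D X (f • Y) = C.act X f • Y + f • D X Y)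

/-- The torsion tensor of a connection. -/
def VFCalculus.torsion (C : VFCalculus F V) (D : V → V → V) (X Y : V) : V :=
  D X Y - D Y X - C.bracket X Y

/-- The curvature tensor of a connection. -/
def VFCalculus.curvature (C : VFCalculus F V) (D : V → V → V) (X Y Z : V) : V :=
  D X (D Y Z) - D Y (D X Z) - D (C.bracket X Y) Z

/-- A contact form `η` on an odd-dimensional manifold, together with its Reeb
vector field `ξ`: `η(ξ) = 1`, `dη(ξ,·) = 0`, and `dη` is nondegenerate on the
contact distribution `D = ker η` (this encodes `η ∧ (dη)ⁿ ≠ 0`). -/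
structure ContactForm (C : VFCalculus F V) where
  η : V → F
  η_add : ∀ X Y, η (X + Y) = η X + η Y
  η_smul : ∀ (f : F) (X : V), η (f • X) = f * η X
  ξ : V
  η_ξ : η ξ = 1
  dη_ξ : ∀ X, C.act ξ (η X) = η (C.bracket ξ X)
  nondeg : ∀ X, η X = 0 →
    (∀ Y, η Y = 0 → C.act X (η Y) - C.act Y (η X) - η (C.bracket X Y) = 0) → X = 0

/-- The exterior differential of the contact form, with the convention
`2 u ∧ v = u ⊗ v - v ⊗ u`, so that
`dη(X,Y) = (1/2) (X(η Y) - Y(η X) - η [X,Y])`. -/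
noncomputable def dEta (C : VFCalculus F V) (S : ContactForm C) (X Y : V) : F :=
  algebraMap ℝ F (1 / 2) * (C.act X (S.η Y) - C.act Y (S.η X) - S.η (C.bracket X Y))

/-- A Legendrian distribution: an `n`-dimensional subbundle of the contact
distribution on which `dη` vanishes; `n`-dimensionality is encoded as maximal
isotropy of each fibre inside the symplectic vector space `(ker η, dη)`. -/
def IsLegendrian (C : VFCalculus F V) (S : ContactForm C) (L : Submodule F V) : Prop :=
  (∀ X ∈ L, S.η X = 0) ∧
  (∀ X ∈ L, ∀ Y ∈ L, dEta C S X Y = 0) ∧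
  (∀ X, S.η X = 0 → (∀ Y ∈ L, dEta C S X Y = 0) → X ∈ L)

/-- A distribution is flat when `[ξ, X] ∈ Γ(L)` for all `X ∈ Γ(L)`. -/
def IsFlatDistrib (C : VFCalculus F V) (S : ContactForm C) (L : Submodule F V) : Prop :=
  ∀ X ∈ L, C.bracket S.ξ X ∈ L

/-- A distribution is integrable when it is stable under the Lie bracket. -/
def IsIntegrableDistrib (C : VFCalculus F V) (L : Submodule F V) : Prop :=
  ∀ X ∈ L, ∀ Y ∈ L, C.bracket X Y ∈ L

/-- The data of an almost bi-Legendrian structure: the two (Legendrian)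
distributions `L₁`, `L₂` are transversal, i.e. `TM = L₁ ⊕ L₂ ⊕ ℝξ`, as
expressed by the associated projection operators `p1`, `p2`. -/
structure BiLegProj (C : VFCalculus F V) (S : ContactForm C)
    (L1 L2 : Submodule F V) where
  p1 : V →ₗ[F] V
  p2 : V →ₗ[F] V
  p1_mem : ∀ X, p1 X ∈ L1
  p2_mem : ∀ X, p2 X ∈ L2
  decomp : ∀ X, X = p1 X + p2 X + S.η X • S.ξ
  p1_of_mem1 : ∀ X ∈ L1, p1 X = X
  p2_of_mem2 : ∀ Y ∈ L2, p2 Y = Y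
  p1_of_mem2 : ∀ Y ∈ L2, p1 Y = 0
  p2_of_mem1 : ∀ X ∈ L1, p2 X = 0
  p1_ξ : p1 S.ξ = 0
  p2_ξ : p2 S.ξ = 0

/-- The characterizing properties of the bi-Legendrian connection of an almost
bi-Legendrian manifold `(M, η, L₁, L₂)`:  it preserves `L₁`, `L₂` and `ℝξ`,
it parallelizes `dη`, and its torsion satisfies `T(X,Y) = 2dη(X,Y)ξ` for
`X ∈ Γ(L₁)`, `Y ∈ Γ(L₂)` and
`T(V,ξ) = [ξ, V_{L₁}]_{L₂} + [ξ, V_{L₂}]_{L₁}` for all `V`. -/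
def IsBiLegConnection (C : VFCalculus F V) (S : ContactForm C)
    (L1 L2 : Submodule F V) (B : BiLegProj C S L1 L2) (D : V → V → V) : Prop :=
  C.IsConnection D ∧
  (∀ U X, X ∈ L1 → D U X ∈ L1) ∧
  (∀ U Y, Y ∈ L2 → D U Y ∈ L2) ∧
  (∀ U, D U S.ξ ∈ Submodule.span F {S.ξ}) ∧
  (∀ U X Y, C.act U (dEta C S X Y) = dEta C S (D U X) Y + dEta C S X (D U Y)) ∧
  (∀ X ∈ L1, ∀ Y ∈ L2, C.torsion D X Y = (2 * dEta C S X Y) • S.ξ) ∧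
  (∀ W, C.torsion D W S.ξ =
    B.p2 (C.bracket S.ξ (B.p1 W)) + B.p1 (C.bracket S.ξ (B.p2 W)))

/-- A contact metric structure `(φ, ξ, η, g)`. -/
structure ContactMetric (C : VFCalculus F V) extends ContactForm C where
  φ : V →ₗ[F] V
  g : V → V → F
  g_symm : ∀ X Y, g X Y = g Y X
  g_add_left : ∀ X Y Z, g (X + Y) Z = g X Z + g Y Z
  g_smul_left : ∀ (f : F) (X Y : V), g (f • X) Y = f * g X Y
  φ_sq : ∀ X, φ (φ X) = -X + η X • ξ
  φ_ξ : φ ξ = 0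
  η_φ : ∀ X, η (φ X) = 0
  g_ξ : ∀ X, g X ξ = η X
  compat : ∀ X Y, dEta C toContactForm X Y = g X (φ Y)

/-- The tensor field `h = (1/2) L_ξ φ`. -/
noncomputable def hTensor (C : VFCalculus F V) (M : ContactMetric C) (X : V) : V :=
  algebraMap ℝ F (1 / 2) • (C.bracket M.ξ (M.φ X) - M.φ (C.bracket M.ξ X))

/-- The Lie derivative of the metric: `(L_X g)(Y,Z)`. -/
def lieDerivG (C : VFCalculus F V) (M : ContactMetric C) (X Y Z : V) : F :=
  C.act X (M.g Y Z) - M.g (C.bracket X Y) Z - M.g Y (C.bracket X Z)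

/-- `g` is bundle-like with respect to the distribution `E`:
`(L_Z g)(Y,Y') = 0` whenever `Z` is a section of `E` and `Y`, `Y'` are
sections of the `g`-orthogonal complement of `E`. -/
def IsBundleLike (C : VFCalculus F V) (M : ContactMetric C) (E : Submodule F V) : Prop :=
  ∀ Z ∈ E, ∀ Y Y' : V, (∀ U ∈ E, M.g Y U = 0) → (∀ U ∈ E, M.g Y' U = 0) →
    lieDerivG C M Z Y Y' = 0

/-- `∇ g = 0`. -/
def MetricCompat (C : VFCalculus F V) (M : ContactMetric C) (D : V → V → V) : Prop :=
  ∀ U X Y, C.act U (M.g X Y) = M.g (D U X) Y + M.g X (D U Y)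

/-- `∇ φ = 0`. -/
def PhiCompat (C : VFCalculus F V) (M : ContactMetric C) (D : V → V → V) : Prop :=
  ∀ U X, D U (M.φ X) = M.φ (D U X)

/-- `∇ η = 0`. -/
def EtaCompat (C : VFCalculus F V) (S : ContactForm C) (D : V → V → V) : Prop :=
  ∀ U X, C.act U (S.η X) = S.η (D U X)

/-- `D` is the Levi-Civita connection of `g`: the unique torsion-free metric
connection. -/
def IsLeviCivita (C : VFCalculus F V) (M : ContactMetric C) (D : V → V → V) : Prop :=
  C.IsConnection D ∧ (∀ X Y, C.torsion D X Y = 0) ∧ MetricCompat C M D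

/-- The Sasakian condition, written via the Levi-Civita connection `lc`:
`(∇̂_V φ) W = g(V,W) ξ - η(W) V`. -/
def IsSasakian (C : VFCalculus F V) (M : ContactMetric C) (lc : V → V → V) : Prop :=
  ∀ X Y, lc X (M.φ Y) - M.φ (lc X Y) = M.g X Y • M.ξ - M.η Y • X

/-- K-contact: the Reeb vector field is Killing. -/
def IsKContact (C : VFCalculus F V) (M : ContactMetric C) : Prop :=
  ∀ Y Z, lieDerivG C M M.ξ Y Z = 0

/-- The generalized Tanaka-Webster connection of a contact metric manifold:
`*∇_V W = ∇̂_V W + η(V) φW + η(W)(φV + φhV) + dη(V + hV, W) ξ`. -/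
noncomputable def tanakaWebster (C : VFCalculus F V) (M : ContactMetric C) (lc : V → V → V)
    (X Y : V) : V :=
  lc X Y + M.η X • M.φ Y + M.η Y • (M.φ X + M.φ (hTensor C M X)) +
    dEta C M.toContactForm (X + hTensor C M X) Y • M.ξ

/-- A symplectic form on an (abstract) even-dimensional manifold. -/
structure SymplForm (C : VFCalculus F V) where
  ω : V → V → F
  ω_add_left : ∀ X Y Z, ω (X + Y) Z = ω X Z + ω Y Z
  ω_smul_left : ∀ (f : F) (X Y : V), ω (f • X) Y = f * ω X Y
  ω_antisymm : ∀ X Y, ω X Y = - ω Y X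
  closed : ∀ X Y Z,
    C.act X (ω Y Z) - C.act Y (ω X Z) + C.act Z (ω X Y) -
      ω (C.bracket X Y) Z + ω (C.bracket X Z) Y - ω (C.bracket Y Z) X = 0
  nondeg : ∀ X, (∀ Y, ω X Y = 0) → X = 0

/-- A Lagrangian distribution: an `n`-dimensional subbundle on which `ω`
vanishes; `n`-dimensionality is encoded as fibrewise maximal isotropy. -/
def IsLagrangian (C : VFCalculus F V) (S : SymplForm C) (L : Submodule F V) : Prop :=
  (∀ X ∈ L, ∀ Y ∈ L, S.ω X Y = 0) ∧
  (∀ X, (∀ Y ∈ L, S.ω X Y = 0) → X ∈ L)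

/-- The characterizing properties of the bi-Lagrangian (Hess) connection of a
pair of transversal Lagrangian distributions: the unique symplectic connection
preserving both distributions with `T(X,Y) = 0` for `X ∈ Γ(L₁)`, `Y ∈ Γ(L₂)`. -/
def IsBiLagConnection (C : VFCalculus F V) (S : SymplForm C)
    (L1 L2 : Submodule F V) (D : V → V → V) : Prop :=
  C.IsConnection D ∧
  (∀ U X Y, C.act U (S.ω X Y) = S.ω (D U X) Y + S.ω X (D U Y)) ∧
  (∀ U X, X ∈ L1 → D U X ∈ L1) ∧
  (∀ U Y, Y ∈ L2 → D U Y ∈ L2) ∧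
  (∀ X ∈ L1, ∀ Y ∈ L2, C.torsion D X Y = 0)

theorem eq_zero_of_two_mul_eq_zero {R : Type*} [CommRing R] [Algebra ℝ R] {a : R}
    (h : 2 * a = 0) : a = 0 := by
  have h2 : algebraMap ℝ R (1 / 2) * 2 = 1 := by
    rw [← map_ofNat (algebraMap ℝ R) 2, ← map_mul]
    norm_num
  calc a = algebraMap ℝ R (1 / 2) * (2 * a) := by rw [← mul_assoc, h2, one_mul]
    _ = 0 := by rw [h, mul_zero]

namespace VFCalculus

variable (C : VFCalculus F V)

theorem bracket_add_right (X Y Z : V) :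
    C.bracket X (Y + Z) = C.bracket X Y + C.bracket X Z := by
  rw [C.bracket_antisymm X (Y + Z), C.bracket_add_left, C.bracket_antisymm Y X,
    C.bracket_antisymm Z X]
  abel

theorem act_zero (X : V) : C.act X 0 = 0 := by
  simpa using C.act_const X 0

theorem act_one (X : V) : C.act X 1 = 0 := by
  simpa using C.act_const X 1

theorem act_neg (X : V) (f : F) : C.act X (-f) = -C.act X f := by
  have h := C.act_add_right X f (-f)
  rw [add_neg_cancel, act_zero] at h
  linear_combination -h

theorem act_sub (X : V) (f g : F) : C.act X (f - g) = C.act X f - C.act X g := by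
  rw [sub_eq_add_neg, C.act_add_right, act_neg, sub_eq_add_neg]

theorem torsion_antisymm (D : V → V → V) (X Y : V) :
    C.torsion D X Y = -C.torsion D Y X := by
  simp only [torsion, C.bracket_antisymm X Y]
  abel

variable {C} in
theorem IsConnection.torsion_add_left {D : V → V → V} (hD : C.IsConnection D) (X Y Z : V) :
    C.torsion D (X + Y) Z = C.torsion D X Z + C.torsion D Y Z := by
  simp only [torsion, hD.1, hD.2.2.1, C.bracket_add_left]
  abel

variable {C} in
theorem IsConnection.torsion_add_right {D : V → V → V} (hD : C.IsConnection D) (X Y Z : V) :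
    C.torsion D X (Y + Z) = C.torsion D X Y + C.torsion D X Z := by
  simp only [torsion, hD.1, hD.2.2.1, C.bracket_add_right]
  abel

end VFCalculus

namespace ContactForm

variable {C : VFCalculus F V} (S : ContactForm C)

theorem η_neg (X : V) : S.η (-X) = -S.η X := by
  simpa using S.η_smul (-1) X

theorem η_zero : S.η 0 = 0 := by
  simpa using S.η_smul 0 0

theorem η_sub (X Y : V) : S.η (X - Y) = S.η X - S.η Y := by
  rw [sub_eq_add_neg, S.η_add, η_neg, sub_eq_add_neg]

theorem dEta_antisymm (X Y : V) : dEta C S X Y = -dEta C S Y X := by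
  simp only [dEta, C.bracket_antisymm X Y, η_neg]
  ring

theorem dEta_closed (X Y Z : V) :
    C.act X (dEta C S Y Z) + C.act Y (dEta C S Z X) + C.act Z (dEta C S X Y)
      - dEta C S (C.bracket X Y) Z - dEta C S (C.bracket Y Z) X
      - dEta C S (C.bracket Z X) Y = 0 := by
  have hJ := congrArg S.η (C.jacobi X Y Z)
  simp only [S.η_add, S.η_zero] at hJ
  rw [C.bracket_antisymm X (C.bracket Y Z), C.bracket_antisymm Y (C.bracket Z X),
    C.bracket_antisymm Z (C.bracket X Y)] at hJ
  simp only [η_neg] at hJ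
  simp only [dEta, C.act_mul_right, C.act_const, C.act_sub, C.act_bracket]
  linear_combination -algebraMap ℝ F (1 / 2) * hJ

theorem eq_zero_of_dEta_eq_zero {X : V} (hX : S.η X = 0)
    (h : ∀ Y, S.η Y = 0 → dEta C S X Y = 0) : X = 0 := by
  refine S.nondeg X hX fun Y hY => ?_
  have h2 : (2 : F) * algebraMap ℝ F (1 / 2) = 1 := by
    rw [← map_ofNat (algebraMap ℝ F) 2, ← map_mul]
    norm_num
  have := h Y hY
  rw [dEta] at this
  linear_combination 2 * this
    - (C.act X (S.η Y) - C.act Y (S.η X) - S.η (C.bracket X Y)) * h2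

end ContactForm

namespace ContactMetric

variable {C : VFCalculus F V} (M : ContactMetric C)

theorem g_add_right (X Y Z : V) : M.g X (Y + Z) = M.g X Y + M.g X Z := by
  rw [M.g_symm, M.g_add_left, M.g_symm Y, M.g_symm Z]

theorem g_smul_right (f : F) (X Y : V) : M.g X (f • Y) = f * M.g X Y := by
  rw [M.g_symm, M.g_smul_left, M.g_symm Y]

theorem g_neg_left (X Y : V) : M.g (-X) Y = -M.g X Y := by
  simpa using M.g_smul_left (-1) X Y

theorem g_neg_right (X Y : V) : M.g X (-Y) = -M.g X Y := by
  rw [M.g_symm, g_neg_left, M.g_symm Y]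

theorem g_sub_left (X Y Z : V) : M.g (X - Y) Z = M.g X Z - M.g Y Z := by
  rw [sub_eq_add_neg, M.g_add_left, g_neg_left, sub_eq_add_neg]

theorem g_ξ_left (X : V) : M.g M.ξ X = M.η X := by
  rw [M.g_symm, M.g_ξ]

theorem dEta_add_left (X Y Z : V) : dEta C M.toContactForm (X + Y) Z =
    dEta C M.toContactForm X Z + dEta C M.toContactForm Y Z := by
  simp only [M.compat, M.g_add_left]

theorem dEta_sub_left (X Y Z : V) : dEta C M.toContactForm (X - Y) Z =
    dEta C M.toContactForm X Z - dEta C M.toContactForm Y Z := by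
  simp only [M.compat, M.g_sub_left]

theorem dEta_add_right (X Y Z : V) : dEta C M.toContactForm X (Y + Z) =
    dEta C M.toContactForm X Y + dEta C M.toContactForm X Z := by
  simp only [M.compat, map_add, M.g_add_right]

theorem dEta_smul_ξ_left (f : F) (X : V) : dEta C M.toContactForm (f • M.ξ) X = 0 := by
  rw [M.compat, M.g_smul_left, M.g_ξ_left, M.η_φ, mul_zero]

theorem eq_zero_of_g_eq_zero {X : V} (hX : M.η X = 0)
    (h : ∀ Y, M.η Y = 0 → M.g X Y = 0) : X = 0 :=
  M.eq_zero_of_dEta_eq_zero hX fun Y _ => by rw [M.compat, h _ (M.η_φ Y)]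

/-- `φ` preserves `dη` on the contact distribution. -/
theorem dEta_φ_φ {X X' : V} (hX' : M.η X' = 0) :
    dEta C M.toContactForm (M.φ X) (M.φ X') = dEta C M.toContactForm X X' := by
  rw [M.compat, M.φ_sq, hX', zero_smul, add_zero, M.g_neg_right, M.g_symm, ← M.compat,
    ← M.dEta_antisymm]

theorem metricCompat_η {D : V → V → V} (hg : MetricCompat C M D) (U X : V) :
    C.act U (M.η X) = M.η (D U X) + M.g X (D U M.ξ) := by
  simpa only [M.g_ξ] using hg U X M.ξ

theorem η_cov_ξ {D : V → V → V} (hg : MetricCompat C M D) (U : V) :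
    M.η (D U M.ξ) = 0 := by
  have h := M.metricCompat_η hg U M.ξ
  rw [M.η_ξ, C.act_one, M.g_ξ_left] at h
  exact eq_zero_of_two_mul_eq_zero (by linear_combination -h)

theorem cov_ξ_eq_zero {D : V → V → V} (hg : MetricCompat C M D) {U : V}
    (hU : D U M.ξ ∈ Submodule.span F {M.ξ}) : D U M.ξ = 0 := by
  obtain ⟨f, hf⟩ := Submodule.mem_span_singleton.1 hU
  have h := M.η_cov_ξ hg U
  rw [← hf, M.η_smul, M.η_ξ, mul_one] at h
  rw [← hf, h, zero_smul]

/-- On a Sasakian manifold, `∇̂_X ξ = -φX`. -/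
theorem leviCivita_ξ {lc : V → V → V} (hlc : IsLeviCivita C M lc) (hSas : IsSasakian C M lc)
    (X : V) : lc X M.ξ = -M.φ X := by
  have hη := M.η_cov_ξ hlc.2.2 X
  have h0 : lc X 0 = 0 := by
    have := hlc.1.2.2.1 X 0 0
    simpa using this
  have h := congrArg M.φ (hSas X M.ξ)
  simp only [M.φ_ξ, h0, zero_sub, map_neg, M.φ_sq, hη, map_sub, map_smul, M.η_ξ, one_smul,
    zero_smul, smul_zero, add_zero, neg_neg] at h
  exact h

/-- On a Sasakian manifold, the Reeb vector field preserves `φ`. -/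
theorem bracket_ξ_φ {lc : V → V → V} (hlc : IsLeviCivita C M lc) (hSas : IsSasakian C M lc)
    (X : V) : C.bracket M.ξ (M.φ X) = M.φ (C.bracket M.ξ X) := by
  have hb (Y : V) : C.bracket M.ξ Y = lc M.ξ Y + M.φ Y := by
    have h := hlc.2.1 M.ξ Y
    rw [VFCalculus.torsion, M.leviCivita_ξ hlc hSas, sub_neg_eq_add, sub_eq_zero] at h
    exact h.symm
  have h := hSas M.ξ X
  rw [M.g_ξ_left, sub_self, sub_eq_zero] at h
  rw [hb, hb, h, map_add]

end ContactMetric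

section BianchiIdentity

variable {C : VFCalculus F V} (M : ContactMetric C) {D : V → V → V}

/-- The first Bianchi-type identity for a connection parallelizing `dη`. -/
theorem dEta_torsion_cyclic
    (h : ∀ U X Y, C.act U (dEta C M.toContactForm X Y) =
      dEta C M.toContactForm (D U X) Y + dEta C M.toContactForm X (D U Y)) (X Y Z : V) :
    dEta C M.toContactForm (C.torsion D X Y) Z + dEta C M.toContactForm (C.torsion D Y Z) X
      + dEta C M.toContactForm (C.torsion D Z X) Y = 0 := by
  have hc := M.dEta_closed X Y Z
  rw [h, h, h, M.dEta_antisymm Y (D X Z), M.dEta_antisymm Z (D Y X),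
    M.dEta_antisymm X (D Z Y)] at hc
  simp only [VFCalculus.torsion, M.dEta_sub_left]
  linear_combination hc

/-- A connection preserving an integrable isotropic distribution and parallelizing `dη` has no
torsion along it, provided its torsion against a complement is vertical. -/
theorem torsion_eq_zero_of_isotropic
    (h : ∀ U X Y, C.act U (dEta C M.toContactForm X Y) =
      dEta C M.toContactForm (D U X) Y + dEta C M.toContactForm X (D U Y))
    {P P' : Submodule F V} (hP : ∀ X ∈ P, M.η X = 0)
    (hiso : ∀ X ∈ P, ∀ Y ∈ P, dEta C M.toContactForm X Y = 0)
    (hint : IsIntegrableDistrib C P) (hpres : ∀ U X, X ∈ P → D U X ∈ P)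
    (hdec : ∀ Z, M.η Z = 0 → ∃ X ∈ P, ∃ Y ∈ P', Z = X + Y)
    (hT : ∀ X ∈ P, ∀ Y ∈ P', ∃ f : F, C.torsion D X Y = f • M.ξ)
    {X X' : V} (hX : X ∈ P) (hX' : X' ∈ P) : C.torsion D X X' = 0 := by
  have hmem : C.torsion D X X' ∈ P :=
    P.sub_mem (P.sub_mem (hpres _ _ hX') (hpres _ _ hX)) (hint _ hX _ hX')
  refine M.eq_zero_of_dEta_eq_zero (hP _ hmem) fun Z hZ => ?_
  obtain ⟨A, hA, Y, hY, rfl⟩ := hdec Z hZ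
  obtain ⟨f, hf⟩ := hT X hX Y hY
  obtain ⟨f', hf'⟩ := hT X' hX' Y hY
  have hc := dEta_torsion_cyclic M h X X' Y
  rw [C.torsion_antisymm D Y X, hf, hf', ← neg_smul, M.dEta_smul_ξ_left,
    M.dEta_smul_ξ_left, add_zero, add_zero] at hc
  rw [M.dEta_add_right, hiso _ hmem _ hA, hc, add_zero]

/-- A metric connection with `∇ξ = 0` whose torsion on `ker η` is `2dη ⊗ ξ` differs on `ker η`
from the Levi-Civita connection of a Sasakian manifold by `dη ⊗ ξ`. -/
theorem sub_leviCivita_of_torsion {lc : V → V → V} (hg : MetricCompat C M D)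
    (hξ : ∀ U, D U M.ξ = 0)
    (hT : ∀ Z Z', M.η Z = 0 → M.η Z' = 0 →
      C.torsion D Z Z' = (2 * dEta C M.toContactForm Z Z') • M.ξ)
    (hlc : IsLeviCivita C M lc) (hSas : IsSasakian C M lc)
    {Z Z' : V} (hZ : M.η Z = 0) (hZ' : M.η Z' = 0) :
    D Z Z' - lc Z Z' = dEta C M.toContactForm Z Z' • M.ξ := by
  set s : V → V → V → F := fun A B E => M.g (D A B - lc A B) E with hs
  have hsymm (A B E : V) (hA : M.η A = 0) (hB : M.η B = 0) (hE : M.η E = 0) :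
      s A B E = s B A E := by
    have h1 := congrArg (M.g · E) (hT A B hA hB)
    have h2 := congrArg (M.g · E) (hlc.2.1 A B)
    have h0 : M.g 0 E = 0 := by simpa using M.g_smul_left 0 0 E
    simp only [VFCalculus.torsion, M.g_sub_left, M.g_smul_left, M.g_ξ_left, hE, h0] at h1 h2
    simp only [hs, M.g_sub_left]
    linear_combination h1 - h2
  have hanti (A B E : V) : s A B E = -s A E B := by
    have h1 := hg A B E
    have h2 := hlc.2.2 A B E
    simp only [hs, M.g_sub_left, M.g_symm _ B] at h1 h2 ⊢
    linear_combination h2 - h1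
  have hzero (E : V) (hE : M.η E = 0) : s Z Z' E = 0 := by
    refine eq_zero_of_two_mul_eq_zero ?_
    linear_combination hanti Z Z' E - hsymm Z E Z' hZ hE hZ' - hanti E Z Z'
      + hsymm E Z' Z hE hZ' hZ + hanti Z' E Z + hsymm Z Z' E hZ hZ' hE
  have hη : M.η (D Z Z' - lc Z Z') = dEta C M.toContactForm Z Z' := by
    have h1 := M.metricCompat_η hg Z Z'
    have h2 := M.metricCompat_η hlc.2.2 Z Z'
    have h0 : M.g Z' 0 = 0 := by simpa using M.g_smul_right 0 Z' 0
    rw [hξ, h0] at h1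
    rw [M.leviCivita_ξ hlc hSas, M.g_neg_right, ← M.compat] at h2
    rw [M.η_sub, M.dEta_antisymm Z Z']
    linear_combination h2 - h1
  rw [← sub_eq_zero]
  refine M.eq_zero_of_g_eq_zero ?_ fun E hE => ?_
  · rw [M.η_sub, hη, M.η_smul, M.η_ξ, mul_one, sub_self]
  · rw [M.g_sub_left, M.g_smul_left, M.g_ξ_left, hE, mul_zero, sub_zero]
    exact hzero E hE

end BianchiIdentity

/-- Corollary.  Let `(M, φ, ξ, η, g)` be a Sasakian manifold
foliated by a flat Legendrian foliation with tangent bundle `L` whose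
conjugate Legendrian distribution `Q = φL` is integrable, and suppose the
associated bi-Legendrian connection `∇` satisfies `∇g = 0`.  With
`S(V,W) = ∇_V W - ∇̂_V W` (difference with the Levi-Civita connection), we
have `S(V,ξ) = S(ξ,V) = φV` for all `V`, and `S(Z,Z') = dη(Z,Z')ξ` for all
sections `Z, Z'` of the contact distribution `D = ker η`.  In particular
`∇_X X' = ∇̂_X X'` for `X, X' ∈ Γ(L)` and `∇_Y Y' = ∇̂_Y Y'` for
`Y, Y' ∈ Γ(Q)`. -/
theorem biLegendrian_minus_leviCivita
    (C : VFCalculus F V) (M : ContactMetric C) (L : Submodule F V)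
    (hL : IsLegendrian C M.toContactForm L)
    (hLflat : IsFlatDistrib C M.toContactForm L)
    (hLint : IsIntegrableDistrib C L)
    (hQint : IsIntegrableDistrib C (Submodule.map M.φ L))
    (B : BiLegProj C M.toContactForm L (Submodule.map M.φ L))
    (D : V → V → V)
    (hD : IsBiLegConnection C M.toContactForm L (Submodule.map M.φ L) B D)
    (hg : MetricCompat C M D)
    (lc : V → V → V) (hlc : IsLeviCivita C M lc)
    (hSas : IsSasakian C M lc) :
    (∀ W, D W M.ξ - lc W M.ξ = M.φ W) ∧
    (∀ W, D M.ξ W - lc M.ξ W = M.φ W) ∧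
    (∀ Z Z', M.η Z = 0 → M.η Z' = 0 →
      D Z Z' - lc Z Z' = dEta C M.toContactForm Z Z' • M.ξ) ∧
    (∀ X ∈ L, ∀ X' ∈ L, D X X' = lc X X') ∧
    (∀ Y ∈ Submodule.map M.φ L, ∀ Y' ∈ Submodule.map M.φ L, D Y Y' = lc Y Y') := by
  obtain ⟨hconn, hDL, hDQ, hDξ, hDd, hTLQ, hTξ⟩ := hD
  obtain ⟨hLη, hLiso, -⟩ := hL
  have hξ (U : V) : D U M.ξ = 0 := M.cov_ξ_eq_zero hg (hDξ U)
  have hQη : ∀ Y ∈ Submodule.map M.φ L, M.η Y = 0 := by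
    rintro _ ⟨X, -, rfl⟩
    exact M.η_φ X
  have hQiso : ∀ Y ∈ Submodule.map M.φ L, ∀ Y' ∈ Submodule.map M.φ L,
      dEta C M.toContactForm Y Y' = 0 := by
    rintro _ ⟨X, hX, rfl⟩ _ ⟨X', hX', rfl⟩
    rw [M.dEta_φ_φ (hLη _ hX'), hLiso _ hX _ hX']
  have hdec (Z : V) (hZ : M.η Z = 0) : Z = B.p1 Z + B.p2 Z := by
    have h := B.decomp Z
    rwa [hZ, zero_smul, add_zero] at h
  have hTL {X X' : V} (hX : X ∈ L) (hX' : X' ∈ L) : C.torsion D X X' = 0 :=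
    torsion_eq_zero_of_isotropic M hDd hLη hLiso hLint hDL
      (fun Z hZ => ⟨_, B.p1_mem Z, _, B.p2_mem Z, hdec Z hZ⟩)
      (fun X hX Y hY => ⟨_, hTLQ X hX Y hY⟩) hX hX'
  have hTQ {Y Y' : V} (hY : Y ∈ Submodule.map M.φ L) (hY' : Y' ∈ Submodule.map M.φ L) :
      C.torsion D Y Y' = 0 :=
    torsion_eq_zero_of_isotropic M hDd hQη hQiso hQint hDQ
      (fun Z hZ => ⟨_, B.p2_mem Z, _, B.p1_mem Z, (hdec Z hZ).trans (add_comm _ _)⟩)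
      (fun Y hY X hX => ⟨-(2 * dEta C M.toContactForm X Y), by
        rw [C.torsion_antisymm, hTLQ X hX Y hY, neg_smul]⟩) hY hY'
  have hT (Z Z' : V) (hZ : M.η Z = 0) (hZ' : M.η Z' = 0) :
      C.torsion D Z Z' = (2 * dEta C M.toContactForm Z Z') • M.ξ := by
    rw [hdec Z hZ, hdec Z' hZ']
    have h1 := B.p1_mem Z
    have h1' := B.p1_mem Z'
    have h2 := B.p2_mem Z
    have h2' := B.p2_mem Z'
    rw [hconn.torsion_add_left, hconn.torsion_add_right, hconn.torsion_add_right, hTL h1 h1',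
      hTQ h2 h2', C.torsion_antisymm D (B.p2 Z), hTLQ _ h1 _ h2', hTLQ _ h1' _ h2,
      M.dEta_add_left, M.dEta_add_right, M.dEta_add_right, hLiso _ h1 _ h1', hQiso _ h2 _ h2',
      M.dEta_antisymm (B.p2 Z)]
    module
  have hS (Z Z' : V) (hZ : M.η Z = 0) (hZ' : M.η Z' = 0) :
      D Z Z' - lc Z Z' = dEta C M.toContactForm Z Z' • M.ξ :=
    sub_leviCivita_of_torsion M hg hξ hT hlc hSas hZ hZ'
  refine ⟨fun W => ?_, fun W => ?_, hS, fun X hX X' hX' => ?_, fun Y hY Y' hY' => ?_⟩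
  · rw [hξ, M.leviCivita_ξ hlc hSas, zero_sub, neg_neg]
  · have hQflat : C.bracket M.ξ (B.p2 W) ∈ Submodule.map M.φ L := by
      obtain ⟨X, hX, hXW⟩ := B.p2_mem W
      rw [← hXW, M.bracket_ξ_φ hlc hSas]
      exact Submodule.mem_map_of_mem (hLflat X hX)
    have h1 := hTξ W
    rw [B.p2_of_mem1 _ (hLflat _ (B.p1_mem W)), B.p1_of_mem2 _ hQflat, VFCalculus.torsion, hξ]
      at h1
    have h2 := hlc.2.1 W M.ξ
    rw [VFCalculus.torsion, M.leviCivita_ξ hlc hSas] at h2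
    linear_combination (norm := module) h2 - h1
  · rw [← sub_eq_zero, hS X X' (hLη X hX) (hLη X' hX'), hLiso X hX X' hX', zero_smul]
  · rw [← sub_eq_zero, hS Y Y' (hQη Y hY) (hQη Y' hY'), hQiso Y hY Y' hY', zero_smul]
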